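/- There is no tripartite pure state |Ψ⟩_ABC such that two of its bipartite reduced states are PPT and entangled (i.e., PPT but not separable). -/

import Mathlib

open Matrix BigOperators
open scoped ComplexOrder

noncomputable section

/-- A density matrix: positive semidefinite with trace one. -/
def IsDensity {α : Type*} [Fintype α] (ρ : Matrix α α ℂ) : Prop :=
  ρ.PosSemidef ∧ ρ.trace = 1

/-- Tensor (Kronecker) product of matrices on a product index type. -/
def tens {α β : Type*} (σ : Matrix α α ℂ) (τ : Matrix β β ℂ) :
    Matrix (α × β) (α × β) ℂ :=
  fun p q => σ p.1 q.1 * τ p.2 q.2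

/-- Separability: a finite convex combination of product density matrices. -/
def SeparableState {α β : Type*} [Fintype α] [Fintype β]
    (ρ : Matrix (α × β) (α × β) ℂ) : Prop :=
  ∃ (k : ℕ) (p : Fin k → ℝ) (σ : Fin k → Matrix α α ℂ) (τ : Fin k → Matrix β β ℂ),
    (∀ i, 0 ≤ p i) ∧ ∑ i, p i = 1 ∧ (∀ i, IsDensity (σ i)) ∧ (∀ i, IsDensity (τ i)) ∧
    ρ = ∑ i, (p i : ℂ) • tens (σ i) (τ i)

/-- Partial transpose with respect to the second system. -/
def ptransB {α β : Type*} (ρ : Matrix (α × β) (α × β) ℂ) :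
    Matrix (α × β) (α × β) ℂ :=
  fun p q => ρ (p.1, q.2) (q.1, p.2)

/-- Partial trace over the second system. -/
def ptrB {α β : Type*} [Fintype β] (ρ : Matrix (α × β) (α × β) ℂ) : Matrix α α ℂ :=
  fun i k => ∑ j, ρ (i, j) (k, j)

/-- Partial trace over the first system. -/
def ptrA {α β : Type*} [Fintype α] (ρ : Matrix (α × β) (α × β) ℂ) : Matrix β β ℂ :=
  fun j l => ∑ i, ρ (i, j) (i, l)

/-- Rank-one projection |ψ⟩⟨ψ| associated with a vector. -/
def projv {α : Type*} (ψ : α → ℂ) : Matrix α α ℂ :=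
  fun x y => ψ x * (starRingEnd ℂ) (ψ y)

/-- Unit vector condition. -/
def UnitVec {α : Type*} [Fintype α] (ψ : α → ℂ) : Prop :=
  ∑ x, Complex.normSq (ψ x) = 1

/-- Two-party reduced state ρ_АБ of a tripartite pure state. -/
def rhoAB {α β γ : Type*} [Fintype γ] (ψ : α × β × γ → ℂ) :
    Matrix (α × β) (α × β) ℂ :=
  fun p q => ∑ c, ψ (p.1, p.2, c) * (starRingEnd ℂ) (ψ (q.1, q.2, c))

def rhoBC {α β γ : Type*} [Fintype α] (ψ : α × β × γ → ℂ) :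
    Matrix (β × γ) (β × γ) ℂ :=
  fun p q => ∑ a, ψ (a, p.1, p.2) * (starRingEnd ℂ) (ψ (a, q.1, q.2))

def rhoAC {α β γ : Type*} [Fintype β] (ψ : α × β × γ → ℂ) :
    Matrix (α × γ) (α × γ) ℂ :=
  fun p q => ∑ b, ψ (p.1, b, p.2) * (starRingEnd ℂ) (ψ (q.1, b, q.2))

def rhoA {α β γ : Type*} [Fintype β] [Fintype γ] (ψ : α × β × γ → ℂ) :
    Matrix α α ℂ :=
  fun x y => ∑ b, ∑ c, ψ (x, b, c) * (starRingEnd ℂ) (ψ (y, b, c))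

def rhoB {α β γ : Type*} [Fintype α] [Fintype γ] (ψ : α × β × γ → ℂ) :
    Matrix β β ℂ :=
  fun x y => ∑ a, ∑ c, ψ (a, x, c) * (starRingEnd ℂ) (ψ (a, y, c))

def rhoC {α β γ : Type*} [Fintype α] [Fintype β] (ψ : α × β × γ → ℂ) :
    Matrix γ γ ℂ :=
  fun x y => ∑ a, ∑ b, ψ (a, b, x) * (starRingEnd ℂ) (ψ (a, b, y))

/-- `x` majorizes `y` (for nonnegative vectors, with implicit zero padding):
the sum of any `|T|` entries of `y` is dominated by some choice of at most
`|T|` entries of `x`, and the total sums agree. -/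
def Majorizes {α β : Type*} [Fintype α] [Fintype β] (x : α → ℝ) (y : β → ℝ) : Prop :=
  (∀ T : Finset β, ∃ S : Finset α, S.card ≤ T.card ∧ ∑ i ∈ T, y i ≤ ∑ i ∈ S, x i) ∧
  ∑ i, x i = ∑ i, y i

/-- Von Neumann entropy of a Hermitian matrix, via its eigenvalues. -/
def vN {α : Type*} [Fintype α] [DecidableEq α] {ρ : Matrix α α ℂ}
    (h : ρ.IsHermitian) : ℝ :=
  -∑ i, h.eigenvalues i * Real.log (h.eigenvalues i)

/-- Tensor rank of a tripartite vector: least number of product vectors summing to it. -/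
def tensorRank {α β γ : Type*} [Fintype α] [Fintype β] [Fintype γ]
    (ψ : α × β × γ → ℂ) : ℕ :=
  sInf {r : ℕ | ∃ (a : Fin r → α → ℂ) (b : Fin r → β → ℂ) (c : Fin r → γ → ℂ),
    ∀ x, ψ x = ∑ i, a i x.1 * b i x.2.1 * c i x.2.2}

/-- Orthonormal family of vectors. -/
def OrthonormalFam {α : Type*} [Fintype α] {k : ℕ} (v : Fin k → α → ℂ) : Prop :=
  ∀ i j, ∑ x, (starRingEnd ℂ) (v i x) * v j x = if i = j then 1 else 0

/-- Maximally correlated state: ρ = Σ_{i,j} c_{ij} |i_B⟩⟨j_B| ⊗ |i_C⟩⟨j_C|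
for some orthonormal families. -/
def IsMaxCorrelated {β γ : Type*} [Fintype β] [Fintype γ]
    (ρ : Matrix (β × γ) (β × γ) ℂ) : Prop :=
  ∃ (k : ℕ) (c : Matrix (Fin k) (Fin k) ℂ) (e : Fin k → β → ℂ) (f : Fin k → γ → ℂ),
    OrthonormalFam e ∧ OrthonormalFam f ∧
    ∀ p q, ρ p q = ∑ i, ∑ j,
      c i j * (e i p.1 * (starRingEnd ℂ) (e j q.1)) * (f i p.2 * (starRingEnd ℂ) (f j q.2))

/-- A commuting family of Hermitian matrices has a common orthonormal eigenbasis. -/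
theorem exists_unitary_simul_diag {ι r : Type*} [Fintype r] [DecidableEq r]
    (N : ι → Matrix r r ℂ) (hN : ∀ i, (N i).IsHermitian)
    (hc : ∀ i j, N i * N j = N j * N i) :
    ∃ (U : Matrix r r ℂ) (d : ι → r → ℂ), Uᴴ * U = 1 ∧ ∀ i, N i * U = U * diagonal (d i) := by
  classical
  let T : ι → EuclideanSpace ℂ r →ₗ[ℂ] EuclideanSpace ℂ r := fun i => toEuclideanLin (N i)
  have hT : ∀ i, (T i).IsSymmetric := fun i => isSymmetric_toEuclideanLin_iff.2 (hN i)
  have hC : Pairwise (Function.onFun Commute T) := fun i j _ => by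
    change toEuclideanLin (N i) ∘ₗ toEuclideanLin (N j) =
      toEuclideanLin (N j) ∘ₗ toEuclideanLin (N i)
    ext x k
    simp [toEuclideanLin, hc i j]
  have hint := LinearMap.IsSymmetric.directSum_isInternal_of_pairwise_commute hT hC
  have horth := LinearMap.IsSymmetric.orthogonalFamily_iInf_eigenspaces hT
  let v (χ : ι → ℂ) := (stdOrthonormalBasis ℂ
    (⨅ j, Module.End.eigenspace (T j) (χ j) : Submodule ℂ (EuclideanSpace ℂ r)))
  let B := hint.collectedBasis fun χ => (v χ).toBasis
  have hB : Orthonormal ℂ B := hint.collectedBasis_orthonormal horth fun χ => by simp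
  let e := B.indexEquiv (EuclideanSpace.basisFun r ℂ).toBasis
  refine ⟨of fun x k => B (e.symm k) x, fun i k => (e.symm k).1 i, ?_, fun i => ?_⟩
  · ext k l
    have := orthonormal_iff_ite.1 hB (e.symm k) (e.symm l)
    simp only [PiLp.inner_apply, RCLike.inner_apply, e.symm.injective.eq_iff] at this
    simpa [mul_apply, one_apply, mul_comm] using this
  · ext x k
    have h1 := (Submodule.mem_iInf _).1
      (hint.collectedBasis_mem (fun χ => (v χ).toBasis) (e.symm k)) i
    have h2 := congrArg (fun f : EuclideanSpace ℂ r => f x) (Module.End.mem_eigenspace_iff.1 h1)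
    rw [mul_diagonal, mul_comm]
    exact h2

/-- A positive semidefinite matrix is diagonalized by an isometry from a space of dimension equal
to its rank. -/
theorem exists_compression {n : Type*} [Fintype n] [DecidableEq n] {P : Matrix n n ℂ}
    (hP : P.PosSemidef) :
    ∃ (k : ℕ) (l : Fin k → ℝ) (V : Matrix n (Fin k) ℂ), k = P.rank ∧ (∀ i, 0 < l i) ∧
      Vᴴ * V = 1 ∧ P = V * diagonal (fun i => (l i : ℂ)) * Vᴴ := by
  let h := hP.isHermitian
  have e : Fin P.rank ≃ {i // h.eigenvalues i ≠ 0} :=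
    Fintype.equivOfCardEq (by simp [h.rank_eq_card_non_zero_eigs])
  refine ⟨_, fun i => h.eigenvalues (e i),
    of fun x i => (h.eigenvectorUnitary : Matrix n n ℂ) x (e i),
    rfl, fun i => lt_of_le_of_ne (hP.eigenvalues_nonneg _) (e i).2.symm, ?_, ?_⟩
  · ext i j
    have := congrFun (congrFun (Unitary.coe_star_mul_self h.eigenvectorUnitary) (e i)) (e j)
    simpa [mul_apply, one_apply, star_eq_conjTranspose, Subtype.val_injective.eq_iff] using this
  · have h1 := h.spectral_theorem
    rw [Unitary.conjStarAlgAut_apply] at h1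
    generalize (h.eigenvectorUnitary : Matrix n n ℂ) = U at *
    generalize h.eigenvalues = lam at *
    ext x y
    refine (congrFun (congrFun h1 x) y).trans ?_
    rw [mul_apply, mul_apply]
    simp only [mul_diagonal, star_eq_conjTranspose, conjTranspose_apply, of_apply,
      Function.comp_apply]
    rw [e.sum_comp (fun i : {i // lam i ≠ 0} => U x i * (lam i : ℂ) * star (U y i)),
      ← Finset.sum_subtype {i | lam i ≠ 0} (by simp)
        (fun i => U x i * (lam i : ℂ) * star (U y i))]
    refine (Finset.sum_filter_of_ne (p := fun i => lam i ≠ 0) fun i _ hi h0 => hi ?_).symm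
    simp [h0]

/-- Equality in the reduction criterion forces triple commutation. -/
theorem triple_commute {B m r s : Type*} [Fintype B] [Fintype m] [Fintype r] [Fintype s]
    [DecidableEq r] [DecidableEq s] (Φ : B → Matrix r s ℂ) (K : B → Matrix m r ℂ)
    (hK : ∀ b d, (K b)ᴴ * K d = Φ d * (Φ b)ᴴ) (hΦ : ∑ b, Φ b * (Φ b)ᴴ = 1)
    (hcard : Fintype.card s ≤ Fintype.card r) (b d f : B) :
    Φ b * (Φ d)ᴴ * Φ f = Φ f * (Φ d)ᴴ * Φ b := by
  let E : Matrix s s ℂ := ∑ b, (Φ b)ᴴ * Φ b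
  let Z : B → B → Matrix m s ℂ := fun b d => K d * Φ b - K b * Φ d
  have hE : Eᴴ = E := by simp [E, conjTranspose_sum]
  have htr : E.trace = Fintype.card r := by
    have h0 := congrArg trace hΦ
    rw [trace_sum, trace_one] at h0
    simp only [E, trace_sum, ← h0]
    exact Finset.sum_congr rfl fun b _ => trace_mul_comm _ _
  have hZ (b d) : (Z b d)ᴴ * Z b d = (Φ b)ᴴ * (Φ d * (Φ d)ᴴ) * Φ b
      + (Φ d)ᴴ * (Φ b * (Φ b)ᴴ) * Φ d - (Φ b)ᴴ * Φ b * ((Φ d)ᴴ * Φ d)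
      - (Φ d)ᴴ * Φ d * ((Φ b)ᴴ * Φ b) := by
    have h1 : (Z b d)ᴴ * Z b d = (Φ b)ᴴ * ((K d)ᴴ * K d) * Φ b + (Φ d)ᴴ * ((K b)ᴴ * K b) * Φ d
        - (Φ b)ᴴ * ((K d)ᴴ * K b) * Φ d - (Φ d)ᴴ * ((K b)ᴴ * K d) * Φ b := by
      simp only [Z, conjTranspose_sub, conjTranspose_mul, Matrix.sub_mul, Matrix.mul_sub,
        Matrix.mul_assoc]
      abel
    rw [h1, hK, hK, hK, hK]
    simp only [Matrix.mul_assoc]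
  have hsum : ∑ b, ∑ d, (Z b d)ᴴ * Z b d = E + E - E * E - E * E := by
    have e1 : ∑ b, ∑ d, (Φ b)ᴴ * (Φ d * (Φ d)ᴴ) * Φ b = E := by
      simp_rw [← Matrix.sum_mul, ← Matrix.mul_sum, hΦ, Matrix.mul_one, E]
    have e2 : ∑ b, ∑ d, (Φ b)ᴴ * Φ b * ((Φ d)ᴴ * Φ d) = E * E := by
      simp_rw [← Matrix.mul_sum, ← Matrix.sum_mul, E]
    simp only [hZ, Finset.sum_sub_distrib, Finset.sum_add_distrib, e1, e2]
    rw [Finset.sum_comm, e1, Finset.sum_comm, e2]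
  have hnn (b d) : 0 ≤ ((Z b d)ᴴ * Z b d).trace :=
    (posSemidef_conjTranspose_mul_self _).trace_nonneg
  have htot : ∑ b, ∑ d, ((Z b d)ᴴ * Z b d).trace ≤ 0 := by
    have h2 : ∑ b, ∑ d, ((Z b d)ᴴ * Z b d).trace
        = 2 * ((Fintype.card s : ℂ) - Fintype.card r) - 2 * ((1 - E)ᴴ * (1 - E)).trace := by
      simp only [← trace_sum, hsum, conjTranspose_sub, hE, conjTranspose_one, Matrix.sub_mul,
        Matrix.mul_sub, trace_sub, trace_add, htr, Matrix.one_mul, Matrix.mul_one, trace_one]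
      ring
    have h3 : (Fintype.card s : ℂ) - Fintype.card r ≤ 0 := by
      rw [sub_nonpos]; exact_mod_cast hcard
    rw [h2]
    have h4 : 0 ≤ ((1 - E)ᴴ * (1 - E)).trace :=
      (posSemidef_conjTranspose_mul_self _).trace_nonneg
    have h5 : (0 : ℂ) ≤ 2 := by norm_num
    exact sub_nonpos.2 ((mul_nonpos_of_nonneg_of_nonpos h5 h3).trans (mul_nonneg h5 h4))
  have hZ0 (b d) : Z b d = 0 := by
    refine trace_conjTranspose_mul_self_eq_zero_iff.1 ?_
    generalize htdef : (fun b d => ((Z b d)ᴴ * Z b d).trace) = t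
    replace hnn : ∀ b d, 0 ≤ t b d := by subst htdef; exact hnn
    replace htot : ∑ b, ∑ d, t b d ≤ 0 := by subst htdef; exact htot
    have hrow (b) : 0 ≤ ∑ d, t b d := Finset.sum_nonneg fun d _ => hnn b d
    have h6 := htot.antisymm (Finset.sum_nonneg fun b _ => hrow b)
    have h7 := (Finset.sum_eq_zero_iff_of_nonneg fun b _ => hrow b).1 h6 b (Finset.mem_univ _)
    have h8 := (Finset.sum_eq_zero_iff_of_nonneg fun d _ => hnn b d).1 h7 d (Finset.mem_univ _)
    exact (congrFun (congrFun htdef b) d).trans h8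
  have h9 : (K d)ᴴ * (K b * Φ f) = (K d)ᴴ * (K f * Φ b) := by
    rw [sub_eq_zero.1 (hZ0 f b)]
  rwa [← Matrix.mul_assoc, ← Matrix.mul_assoc, hK, hK] at h9

/-- A matrix annihilating `∑ b, Ψ b * (Ψ b)ᴴ` annihilates every `Ψ b`. -/
theorem mul_eq_zero_of_mul_sum_eq_zero {B n a c : Type*} [Fintype B] [Fintype n] [Fintype a]
    [Fintype c] (Ψ : B → Matrix a c ℂ) (X : Matrix n a ℂ)
    (h : X * ∑ b, Ψ b * (Ψ b)ᴴ = 0) (b : B) : X * Ψ b = 0 := by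
  have h1 : ∑ b, ((X * Ψ b) * (X * Ψ b)ᴴ).trace = 0 := by
    rw [← trace_sum]
    have : ∑ b, (X * Ψ b) * (X * Ψ b)ᴴ = X * (∑ b, Ψ b * (Ψ b)ᴴ) * Xᴴ := by
      simp only [Matrix.mul_sum, Matrix.sum_mul, conjTranspose_mul, Matrix.mul_assoc]
    rw [this, h, Matrix.zero_mul, trace_zero]
  have hnn (b) : 0 ≤ ((X * Ψ b) * (X * Ψ b)ᴴ).trace :=
    (posSemidef_self_mul_conjTranspose _).trace_nonneg
  refine trace_mul_conjTranspose_self_eq_zero_iff.1 ?_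
  exact (Finset.sum_eq_zero_iff_of_nonneg fun b _ => hnn b).1 h1 b (Finset.mem_univ _)

/-- A family of matrices `Φ` satisfying triple commutation has simultaneously diagonalizable
products `Φ b * (Φ d)ᴴ`. -/
theorem exists_diag_of_triple_commute {B r s : Type*} [Fintype r] [Fintype s] [DecidableEq r]
    (Φ : B → Matrix r s ℂ)
    (hΦ : ∀ b d f, Φ b * (Φ d)ᴴ * Φ f = Φ f * (Φ d)ᴴ * Φ b) :
    ∃ (U : Matrix r r ℂ) (e : B → B → r → ℂ), Uᴴ * U = 1 ∧
      ∀ b d, Φ b * (Φ d)ᴴ * U = U * diagonal (e b d) := by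
  let N : B → B → Matrix r r ℂ := fun b d => Φ b * (Φ d)ᴴ
  have hstar (b d) : (N b d)ᴴ = N d b := by simp [N]
  have hN (b d f g) : N b d * N f g = N f g * N b d := by
    have hs : (Φ d)ᴴ * Φ f * (Φ g)ᴴ = (Φ g)ᴴ * Φ f * (Φ d)ᴴ := by
      simpa [Matrix.mul_assoc] using congrArg conjTranspose (hΦ g f d)
    calc N b d * N f g = Φ b * ((Φ d)ᴴ * Φ f * (Φ g)ᴴ) := by simp only [N, Matrix.mul_assoc]
      _ = Φ b * (Φ g)ᴴ * Φ f * (Φ d)ᴴ := by rw [hs]; simp only [Matrix.mul_assoc]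
      _ = N f g * N b d := by rw [hΦ]; simp only [N, Matrix.mul_assoc]
  let H : (B × B) × Bool → Matrix r r ℂ := fun p =>
    if p.2 then N p.1.1 p.1.2 + N p.1.2 p.1.1
    else Complex.I • (N p.1.1 p.1.2 - N p.1.2 p.1.1)
  have hHN (p f g) : Commute (H p) (N f g) := by
    simp only [H]
    split_ifs
    · exact Commute.add_left (hN ..) (hN ..)
    · exact (Commute.sub_left (hN ..) (hN ..)).smul_left _
  have hH (p q) : Commute (H p) (H q) := by
    change Commute (H p) (if q.2 then _ else _)
    split_ifs
    · exact (hHN ..).add_right (hHN ..)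
    · exact ((hHN ..).sub_right (hHN ..)).smul_right _
  obtain ⟨U, d, hU, hd⟩ := exists_unitary_simul_diag H
    (by
      rintro ⟨⟨b, d⟩, _ | _⟩
      · simp only [H, IsHermitian, Bool.false_eq_true, if_false, conjTranspose_smul,
          conjTranspose_sub, hstar]
        simp only [Complex.star_def, Complex.conj_I, neg_smul, ← smul_neg, neg_sub]
      · simp only [H, IsHermitian, if_true, conjTranspose_add, hstar, add_comm])
    fun p q => hH p q
  refine ⟨U, fun b f => (1 / 2 : ℂ) • (d ((b, f), true) - Complex.I • d ((b, f), false)), hU,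
    fun b f => ?_⟩
  have h1 : N b f = (1 / 2 : ℂ) • (H ((b, f), true) - Complex.I • H ((b, f), false)) := by
    simp only [H, Bool.false_eq_true, if_false, if_true, smul_smul, Complex.I_mul_I]
    module
  change N b f * U = _
  have h2 : diagonal ((1 / 2 : ℂ) • (d ((b, f), true) - Complex.I • d ((b, f), false))) =
      (1 / 2 : ℂ) • (diagonal (d ((b, f), true)) - Complex.I • diagonal (d ((b, f), false))) := by
    rw [← diagonal_smul, diagonal_sub, ← diagonal_smul]
    rfl
  rw [h1, h2]
  simp only [Matrix.smul_mul, Matrix.sub_mul, Matrix.mul_smul, Matrix.mul_sub, hd]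

/-- If the block matrix with blocks `Ψ d * (Ψ b)ᴴ` is positive semidefinite and the rank of
`∑ b, (Ψ b)ᴴ * Ψ b` does not exceed that of `∑ b, Ψ b * (Ψ b)ᴴ`, then the block matrix with blocks
`Ψ b * (Ψ d)ᴴ` is a sum of products of positive semidefinite matrices. -/
theorem exists_product_decomposition {B m a c : Type*} [Fintype B] [Fintype m] [Fintype a]
    [Fintype c] [DecidableEq a] [DecidableEq c] (Ψ : B → Matrix a c ℂ) (K : B → Matrix m a ℂ)
    (hK : ∀ b d, (K b)ᴴ * K d = Ψ d * (Ψ b)ᴴ)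
    (hrank : (∑ b, (Ψ b)ᴴ * Ψ b).rank ≤ (∑ b, Ψ b * (Ψ b)ᴴ).rank) :
    ∃ (k : ℕ) (w : Fin k → Matrix a a ℂ) (n : Fin k → Matrix B B ℂ),
      (∀ i, (w i).PosSemidef) ∧ (∀ i, (n i).PosSemidef) ∧
      ∀ b d x y, (Ψ b * (Ψ d)ᴴ) x y = ∑ i, w i x y * n i b d := by
  obtain ⟨k, l, V, hk, hl, hV, hP⟩ := exists_compression
    (posSemidef_sum Finset.univ fun b _ => posSemidef_self_mul_conjTranspose (Ψ b))
  obtain ⟨k', l', V', hk', -, hV', hQ⟩ := exists_compression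
    (posSemidef_sum Finset.univ fun b _ => posSemidef_conjTranspose_mul_self (Ψ b))
  have hVΨ (b) : V * Vᴴ * Ψ b = Ψ b := by
    have := mul_eq_zero_of_mul_sum_eq_zero Ψ (1 - V * Vᴴ) (by
      rw [hP, Matrix.sub_mul, Matrix.one_mul, sub_eq_zero]
      simp only [← Matrix.mul_assoc]
      rw [Matrix.mul_assoc V Vᴴ V, hV, Matrix.mul_one]) b
    rw [Matrix.sub_mul, Matrix.one_mul, sub_eq_zero] at this
    exact this.symm
  have hΨV (b) : V' * V'ᴴ * (Ψ b)ᴴ = (Ψ b)ᴴ := by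
    have := mul_eq_zero_of_mul_sum_eq_zero (fun b => (Ψ b)ᴴ) (1 - V' * V'ᴴ) (by
      simp only [conjTranspose_conjTranspose]
      rw [hQ, Matrix.sub_mul, Matrix.one_mul, sub_eq_zero]
      simp only [← Matrix.mul_assoc]
      rw [Matrix.mul_assoc V' V'ᴴ V', hV', Matrix.mul_one]) b
    rw [Matrix.sub_mul, Matrix.one_mul, sub_eq_zero] at this
    exact this.symm
  let D := diagonal fun i => ((√(l i) : ℝ) : ℂ)
  let D' := diagonal fun i => (((√(l i))⁻¹ : ℝ) : ℂ)
  have hD : Dᴴ = D := by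
    rw [diagonal_conjTranspose]; congr 1; ext; simp
  have hD' : D'ᴴ = D' := by
    rw [diagonal_conjTranspose]; congr 1; ext; simp
  have hne (i) : √(l i) ≠ 0 := (Real.sqrt_pos.2 (hl i)).ne'
  have hDD' : D * D' = 1 := by
    simp only [D, D', diagonal_mul_diagonal, ← Complex.ofReal_mul, mul_inv_cancel₀ (hne _),
      Complex.ofReal_one, diagonal_one]
  have hDDD : D' * diagonal (fun i => (l i : ℂ)) * D' = 1 := by
    have h0 (i) : (√(l i))⁻¹ * l i * (√(l i))⁻¹ = 1 := by
      nth_rw 2 [← Real.mul_self_sqrt (hl i).le]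
      field_simp [hne i]
    simp only [D', diagonal_mul_diagonal, ← Complex.ofReal_mul, h0,
      Complex.ofReal_one, diagonal_one]
  let Φ : B → Matrix _ _ ℂ := fun b => D' * Vᴴ * Ψ b * V'
  have hΦΦ (b d) : Φ b * (Φ d)ᴴ = D' * Vᴴ * (Ψ b * (Ψ d)ᴴ) * V * D' := by
    simp only [Φ, conjTranspose_mul, conjTranspose_conjTranspose, hD', Matrix.mul_assoc]
    simp only [← Matrix.mul_assoc V' V'ᴴ, ← Matrix.mul_assoc (V' * V'ᴴ) (Ψ d)ᴴ, hΨV]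
  have htriple := triple_commute Φ (fun b => K b * V * D')
    (fun b d => by
      rw [hΦΦ, ← hK]
      simp only [conjTranspose_mul, hD', Matrix.mul_assoc])
    (by
      simp only [hΦΦ]
      rw [← Matrix.sum_mul, ← Matrix.sum_mul, ← Matrix.mul_sum, hP, ← hDDD]
      simp only [Matrix.mul_assoc]
      rw [← Matrix.mul_assoc Vᴴ V D', hV, Matrix.one_mul, ← Matrix.mul_assoc Vᴴ V, hV,
        Matrix.one_mul])
    (by simpa [hk, hk'] using hrank)
  obtain ⟨U, e, hU, he⟩ := exists_diag_of_triple_commute Φ htriple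
  have hU' : U * Uᴴ = 1 := mul_eq_one_comm.1 hU
  let W := V * D * U
  refine ⟨_, fun i => vecMulVec (W.col i) (star (W.col i)), fun i => of fun b d => e b d i,
    fun i => posSemidef_vecMulVec_self_star _, fun i => ?_, fun b d x y => ?_⟩
  · have : (of fun b d => e b d i) = (of fun j b => ((Φ b)ᴴ * U) j i)ᴴ *
        (of fun j b => ((Φ b)ᴴ * U) j i) := by
      ext b d
      have h1 : diagonal (e b d) = ((Φ b)ᴴ * U)ᴴ * ((Φ d)ᴴ * U) := by
        rw [conjTranspose_mul, conjTranspose_conjTranspose, Matrix.mul_assoc,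
          ← Matrix.mul_assoc (Φ b), he, ← Matrix.mul_assoc, hU, Matrix.one_mul]
      have h2 := congrFun (congrFun h1 i) i
      rw [diagonal_apply_eq, mul_apply] at h2
      rw [of_apply, h2, mul_apply]
      rfl
    change (of fun b d => e b d i).PosSemidef
    rw [this]
    exact posSemidef_conjTranspose_mul_self _
  · have h1 : Φ b * (Φ d)ᴴ = U * diagonal (e b d) * Uᴴ := by
      rw [← he, Matrix.mul_assoc _ U, hU', Matrix.mul_one]
    have h2 : Ψ b * (Ψ d)ᴴ = W * diagonal (e b d) * Wᴴ := by
      calc Ψ b * (Ψ d)ᴴ = (V * Vᴴ * Ψ b) * (V * Vᴴ * Ψ d)ᴴ := by rw [hVΨ, hVΨ]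
        _ = V * (D * D') * Vᴴ * (Ψ b * (Ψ d)ᴴ) * V * (D * D')ᴴ * Vᴴ := by
          rw [hDD']
          simp only [conjTranspose_mul, conjTranspose_conjTranspose, Matrix.mul_assoc,
            conjTranspose_one, Matrix.one_mul]
        _ = V * D * (Φ b * (Φ d)ᴴ) * D * Vᴴ := by
          rw [hΦΦ]
          simp only [conjTranspose_mul, hD, hD', Matrix.mul_assoc]
        _ = W * diagonal (e b d) * Wᴴ := by
          rw [h1]
          simp only [W, conjTranspose_mul, hD, Matrix.mul_assoc]
    rw [h2, mul_apply]
    simp only [mul_diagonal, conjTranspose_apply, vecMulVec_apply, of_apply, Pi.star_apply, col_apply]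
    exact Finset.sum_congr rfl fun i _ => by ring

/-- A positive semidefinite matrix is its trace times a density matrix. -/
theorem exists_eq_trace_smul_density {α : Type*} [Fintype α] [Nonempty α] {σ : Matrix α α ℂ}
    (h : σ.PosSemidef) : ∃ σ' : Matrix α α ℂ, IsDensity σ' ∧ σ = (σ.trace.re : ℂ) • σ' := by
  classical
  have hre : ((σ.trace.re : ℝ) : ℂ) = σ.trace :=
    (Complex.eq_re_of_ofReal_le (r := 0) (by simpa using h.trace_nonneg)).symm
  have hnn : 0 ≤ σ.trace.re := (Complex.nonneg_iff.1 h.trace_nonneg).1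
  by_cases h0 : σ.trace = 0
  · obtain ⟨x⟩ := ‹Nonempty α›
    refine ⟨diagonal (Pi.single x 1), ⟨PosSemidef.diagonal ?_, ?_⟩, ?_⟩
    · exact Pi.single_nonneg.2 zero_le_one
    · simp [trace_diagonal]
    · rw [h.trace_eq_zero_iff.1 h0]; simp
  · refine ⟨((σ.trace.re)⁻¹ : ℝ) • σ, ⟨h.smul (inv_nonneg.2 hnn), ?_⟩, ?_⟩
    · rw [trace_smul, Complex.real_smul, Complex.ofReal_inv, hre, inv_mul_cancel₀ h0]
    · rw [← Complex.coe_smul, smul_smul, Complex.ofReal_inv, hre, mul_inv_cancel₀ h0, one_smul]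

/-- A trace-one sum of products of positive semidefinite matrices is separable. -/
theorem separableState_of_sum_tens {α β : Type*} [Fintype α] [Fintype β] {k : ℕ}
    {ρ : Matrix (α × β) (α × β) ℂ} (hρ : ρ.trace = 1) (σ : Fin k → Matrix α α ℂ)
    (τ : Fin k → Matrix β β ℂ) (hσ : ∀ i, (σ i).PosSemidef) (hτ : ∀ i, (τ i).PosSemidef)
    (h : ρ = ∑ i, tens (σ i) (τ i)) : SeparableState ρ := by
  have hne : Nonempty (α × β) := by
    by_contra hemp
    rw [not_nonempty_iff] at hemp
    simp [trace] at hρ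
  have : Nonempty α := hne.map Prod.fst
  have : Nonempty β := hne.map Prod.snd
  choose σ' hσ' hσe using fun i => exists_eq_trace_smul_density (hσ i)
  choose τ' hτ' hτe using fun i => exists_eq_trace_smul_density (hτ i)
  have hρe : ρ = ∑ i, (((σ i).trace.re * (τ i).trace.re : ℝ) : ℂ) • tens (σ' i) (τ' i) := by
    rw [h]
    refine Finset.sum_congr rfl fun i _ => ?_
    ext p q
    simp only [tens, Matrix.smul_apply, smul_eq_mul]
    rw [congrFun (congrFun (hσe i) p.1) q.1, congrFun (congrFun (hτe i) p.2) q.2]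
    simp only [Matrix.smul_apply, smul_eq_mul]
    push_cast
    ring
  refine ⟨k, fun i => (σ i).trace.re * (τ i).trace.re, σ', τ', fun i => mul_nonneg
    (Complex.nonneg_iff.1 (hσ i).trace_nonneg).1 (Complex.nonneg_iff.1 (hτ i).trace_nonneg).1,
    ?_, hσ', hτ', hρe⟩
  have htens (i) : (tens (σ' i) (τ' i)).trace = 1 := by
    have : (tens (σ' i) (τ' i)).trace = (σ' i).trace * (τ' i).trace := by
      simp [trace, tens, Fintype.sum_prod_type, Finset.sum_mul_sum]
    rw [this, (hσ' i).2, (hτ' i).2, mul_one]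
  rw [hρe, trace_sum] at hρ
  simp only [trace_smul, htens, smul_eq_mul, mul_one] at hρ
  exact_mod_cast hρ

open scoped MatrixOrder Matrix.Norms.L2Operator in
/-- A positive semidefinite block matrix is a Gram matrix of blocks. -/
theorem exists_gram_blocks {α β : Type*} [Fintype α] [Fintype β]
    {ρ : Matrix (α × β) (α × β) ℂ} (h : ρ.PosSemidef) :
    ∃ K : β → Matrix (α × β) α ℂ, ∀ b d x y, ((K b)ᴴ * K d) x y = ρ (x, b) (y, d) := by
  classical
  obtain ⟨L, rfl⟩ := CStarAlgebra.nonneg_iff_eq_star_mul_self.mp h.nonneg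
  exact ⟨fun b => of fun p x => L p (x, b), fun b d x y => rfl⟩

/-- no tripartite pure state has two bipartite reduced states
that are both PPT and entangled. -/
theorem no_two_ppt_entangled_reduced_states {a b c : ℕ}
    (ψ : Fin a × Fin b × Fin c → ℂ) (hψ : UnitVec ψ) :
    ¬((ptransB (rhoAB ψ)).PosSemidef ∧ ¬SeparableState (rhoAB ψ) ∧
      (ptransB (rhoBC ψ)).PosSemidef ∧ ¬SeparableState (rhoBC ψ)) := by
  rintro ⟨hAB, hABs, hBC, hBCs⟩
  have hψ' : ∑ x, ∑ y, ∑ z, ψ (x, y, z) * (starRingEnd ℂ) (ψ (x, y, z)) = 1 := by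
    have h := congrArg (fun t : ℝ => (t : ℂ)) hψ
    simpa [Fintype.sum_prod_type, Complex.mul_conj] using h
  let Ψ : Fin b → Matrix (Fin a) (Fin c) ℂ := fun y => of fun x z => ψ (x, y, z)
  rcases le_total (∑ y, (Ψ y)ᴴ * Ψ y).rank (∑ y, Ψ y * (Ψ y)ᴴ).rank with hr | hr
  · obtain ⟨K, hK⟩ := exists_gram_blocks hAB
    obtain ⟨k, w, n, hw, hn, h⟩ := exists_product_decomposition Ψ K
      (fun y y' => by ext x x'; rw [hK]; rfl) hr
    refine hABs (separableState_of_sum_tens ?_ w n hw hn ?_)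
    · simpa [trace, rhoAB, Fintype.sum_prod_type] using hψ'
    · ext ⟨x, y⟩ ⟨x', y'⟩
      rw [Matrix.sum_apply]
      exact h y y' x x'
  · obtain ⟨K, hK⟩ := exists_gram_blocks (hBC.transpose.submatrix Prod.swap)
    obtain ⟨k, w, n, hw, hn, h⟩ := exists_product_decomposition (fun y => (Ψ y)ᵀ) K
      (fun y y' => by ext z z'; rw [hK]; rfl) (by
        have h1 : ∑ y, ((Ψ y)ᵀ)ᴴ * (Ψ y)ᵀ = (∑ y, Ψ y * (Ψ y)ᴴ)ᵀ := by
          simp only [transpose_sum, transpose_mul]; rfl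
        have h2 : ∑ y, (Ψ y)ᵀ * ((Ψ y)ᵀ)ᴴ = (∑ y, (Ψ y)ᴴ * Ψ y)ᵀ := by
          simp only [transpose_sum, transpose_mul]; rfl
        rwa [h1, h2, rank_transpose, rank_transpose])
    refine hBCs (separableState_of_sum_tens ?_ n w hn hw ?_)
    · rw [← hψ', Finset.sum_comm]
      simp only [trace, rhoBC, Fintype.sum_prod_type, diag_apply]
      exact Finset.sum_congr rfl fun y _ => Finset.sum_comm
    · ext ⟨y, z⟩ ⟨y', z'⟩
      rw [Matrix.sum_apply]
      refine (h y y' z z').trans (Finset.sum_congr rfl fun i _ => mul_comm _ _)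

end
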